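/- Let p be a prime and r, n positive integers. For each k,l ∈ {1,…,n}, let q_{kl} be a probability mass function on F_p. Then Σ_{M ∈ M_n(F_p)} (∏_{k,l} q_{kl}(M_{kl}))·S_r(M) = p^{−rn}·Σ over tuples (g_1,…,g_n) ∈ G^n that span G, and over tuples (h_1,…,h_n) ∈ G^n, of ∏_{k=1}^n ∏_{l=1}^n ( Σ_{a∈F_p} q_{kl}(a)·ζ^{a·(g_k·h_l)} ), where S_r(M) is the number of surjective F_p-linear maps F : F_p^n → F_p^r with F∘M = 0. -/

import Mathlib

open scoped Classical

/-- `ζ = e^{2πi/p}`. -/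
noncomputable def zetaP (p : ℕ) : ℂ := Complex.exp (2 * Real.pi * Complex.I / p)

lemma aux_zeta (p : ℕ) [Fact p.Prime] (x : ZMod p) :
    zetaP p ^ x.val = ZMod.stdAddChar x := by
  rw [ZMod.stdAddChar_apply, ZMod.toCircle_apply, zetaP, ← Complex.exp_nat_mul]
  congr 1
  ring

lemma aux_prod_sum {ι κ : Type*} [Fintype ι] [DecidableEq ι] [Fintype κ] (f : ι → κ → ℂ) :
    ∏ i, ∑ a, f i a = ∑ x : ι → κ, ∏ i, f i (x i) := by
  rw [Finset.prod_univ_sum, Fintype.piFinset_univ]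

lemma aux_mapsum {p : ℕ} [Fact p.Prime] {ι : Type*} (s : Finset ι) (f : ι → ZMod p) :
    (ZMod.stdAddChar (∑ i ∈ s, f i) : ℂ) = ∏ i ∈ s, ZMod.stdAddChar (f i) := by
  induction s using Finset.induction_on with
  | empty => simp
  | insert a s ha ih => rw [Finset.sum_insert ha, Finset.prod_insert ha, AddChar.map_add_eq_mul, ih]

lemma aux_orth (p : ℕ) [Fact p.Prime] (r n : ℕ) (v : Fin n → Fin r → ZMod p) :
    ∑ h : Fin n → Fin r → ZMod p, ∏ l, ZMod.stdAddChar (∑ i, v l i * h l i) =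
      if v = 0 then (p : ℂ) ^ (r * n) else 0 := by
  have h1 : ∀ (b : ZMod p), ∑ x : ZMod p, (ZMod.stdAddChar (b * x) : ℂ) =
      if b = 0 then (p : ℂ) else 0 := by
    intro b
    have := AddChar.sum_mulShift (R := ZMod p) (R' := ℂ) b (ZMod.isPrimitive_stdAddChar p)
    rw [ZMod.card] at this
    simp only [mul_comm b]
    rw [this]
    split_ifs <;> simp
  have h2 : ∏ l, ∏ i, ∑ x : ZMod p, (ZMod.stdAddChar (v l i * x) : ℂ) =
      ∑ h : Fin n → Fin r → ZMod p, ∏ l, ZMod.stdAddChar (∑ i, v l i * h l i) := by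
    simp_rw [aux_prod_sum, aux_mapsum]
  rw [← h2]
  simp_rw [h1]
  split_ifs with hv
  · subst hv
    simp [pow_mul]
  · obtain ⟨l, hl⟩ := Function.ne_iff.mp hv
    obtain ⟨i, hi⟩ := Function.ne_iff.mp hl
    apply Finset.prod_eq_zero (Finset.mem_univ l)
    apply Finset.prod_eq_zero (Finset.mem_univ i)
    exact if_neg hi

lemma aux_card (p : ℕ) [Fact p.Prime] (r n : ℕ) (M : Matrix (Fin n) (Fin n) (ZMod p)) :
    (Nat.card {F : (Fin n → ZMod p) →ₗ[ZMod p] (Fin r → ZMod p) //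
            Function.Surjective F ∧ F.comp M.mulVecLin = 0} : ℂ) =
    ∑ g ∈ Finset.univ.filter (fun g : Fin n → Fin r → ZMod p =>
            Submodule.span (ZMod p) (Set.range g) = ⊤),
      if (fun l i => ∑ k, M k l * g k i) = (0 : Fin n → Fin r → ZMod p) then (1 : ℂ) else 0 := by
  rw [Finset.sum_boole, Finset.filter_filter]
  congr 1
  rw [← Fintype.card_subtype, ← Nat.card_eq_fintype_card]
  symm
  refine Nat.card_congr
    (((Pi.basisFun (ZMod p) (Fin n)).constr (ZMod p)).toEquiv.subtypeEquiv ?_)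
  intro g
  refine and_congr ?_ ?_
  · rw [← LinearMap.range_eq_top]
    simp only [LinearEquiv.coe_toEquiv]
    rw [Module.Basis.constr_range]
  · constructor
    · intro h
      refine (Pi.basisFun (ZMod p) (Fin n)).ext fun l => ?_
      have := congrFun h l
      ext i
      simpa [Module.Basis.constr_apply_fintype, Finset.sum_apply] using congrFun this i
    · intro h
      funext l i
      have := congrFun (LinearMap.congr_fun h (Pi.single l 1)) i
      simpa [Module.Basis.constr_apply_fintype, Finset.sum_apply] using this

lemma aux_main (p : ℕ) [Fact p.Prime] (r n : ℕ)
    (q : Fin n → Fin n → ZMod p → ℝ) (g : Fin n → Fin r → ZMod p) :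
    ∑ h : Fin n → Fin r → ZMod p, ∏ k : Fin n, ∏ l : Fin n,
      ∑ a : ZMod p, (q k l a : ℂ) * zetaP p ^ (a * ∑ i, g k i * h l i).val =
    ∑ M : Matrix (Fin n) (Fin n) (ZMod p), ((∏ k : Fin n, ∏ l : Fin n, q k l (M k l) : ℝ) : ℂ) *
      if (fun l i => ∑ k, M k l * g k i) = (0 : Fin n → Fin r → ZMod p)
        then (p : ℂ) ^ (r * n) else 0 := by
  simp_rw [aux_zeta, aux_prod_sum, ← aux_orth, Finset.mul_sum]
  rw [Finset.sum_comm]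
  refine Finset.sum_congr rfl fun M _ => Finset.sum_congr rfl fun h _ => ?_
  simp_rw [Finset.prod_mul_distrib]
  push_cast
  congr 1
  rw [Finset.prod_comm]
  refine Finset.prod_congr rfl fun l _ => ?_
  rw [← aux_mapsum]
  congr 1
  simp only [Finset.sum_mul]
  rw [Finset.sum_comm]
  simp_rw [mul_assoc]



/-- the discrete Fourier identity of Section 2.1.
Let `p` be a prime, `r, n` positive integers, and for each `k, l ∈ [n]` let `q_{kl}` be a
probability mass function on `F_p`. Then
`Σ_M (∏_{k,l} q_{kl}(M_{kl}))·S_r(M)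
  = p^{−rn}·Σ_{(g_k) spanning G} Σ_{(h_l)} ∏_{k,l} Σ_a q_{kl}(a)·ζ^{a(g_k·h_l)}`,
where `G = F_p^r`, `S_r(M)` is the number of surjective linear maps `F : F_p^n → F_p^r`
with `F ∘ M = 0`, and `ζ^m` means `ζ` raised to the integer representative of `m`. -/
theorem stmt_5 (p : ℕ) [Fact p.Prime] (r n : ℕ) (hr : 0 < r) (hn : 0 < n)
    (q : Fin n → Fin n → ZMod p → ℝ)
    (hq0 : ∀ k l a, 0 ≤ q k l a)
    (hq1 : ∀ k l, ∑ a : ZMod p, q k l a = 1) :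
    (∑ M : Matrix (Fin n) (Fin n) (ZMod p),
        ((∏ k : Fin n, ∏ l : Fin n, q k l (M k l) : ℝ) : ℂ) *
          (Nat.card {F : (Fin n → ZMod p) →ₗ[ZMod p] (Fin r → ZMod p) //
            Function.Surjective F ∧ F.comp M.mulVecLin = 0} : ℂ))
      = (p : ℂ) ^ (-(r * n : ℤ)) *
        ∑ g ∈ Finset.univ.filter (fun g : Fin n → Fin r → ZMod p =>
            Submodule.span (ZMod p) (Set.range g) = ⊤),
          ∑ h : Fin n → Fin r → ZMod p,
            ∏ k : Fin n, ∏ l : Fin n,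
              ∑ a : ZMod p, (q k l a : ℂ) * zetaP p ^ (a * ∑ i, g k i * h l i).val := by
  simp_rw [aux_main, aux_card]
  rw [Finset.mul_sum]
  have hp : (p : ℂ) ≠ 0 := Nat.cast_ne_zero.mpr (Fact.out : p.Prime).ne_zero
  have hpp : (p : ℂ) ^ (-(r * n : ℤ)) * (p : ℂ) ^ (r * n) = 1 := by
    rw [zpow_neg, ← Nat.cast_mul, zpow_natCast]
    exact inv_mul_cancel₀ (pow_ne_zero _ hp)
  simp_rw [Finset.mul_sum]
  rw [Finset.sum_comm]
  refine Finset.sum_congr rfl fun g _ => Finset.sum_congr rfl fun M _ => ?_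
  split_ifs
  · rw [mul_left_comm, hpp]
  · simp
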